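/- arXiv:2605.24255 — 2 statements merged into one kernel-verified Lean document; each statement's English description precedes it below -/
import Mathlib

section
/- Let l ≥ 1. There exists T ∈ SYT((∞^l)) such that for every n ∈ ℕ, every partition λ of n with at most l rows, and every standard Young tableau S of shape λ, there is some k ≥ 0 with jdt^k(T)_{i,j} = S_{i,j} for every box (i,j) of λ. In particular, jdt : SYT((∞^l)) → SYT((∞^l)) is topologically transitive with respect to the metric d: for all non-empty open subsets V, W of SYT((∞^l)) there exists n ∈ ℕ with jdt^n(V) ∩ W ≠ ∅. -/
open scoped Classical

/-- A 0-based box `(i, j)` belongs to the infinite shape with `l` rows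
(`l = ⊤` gives the shape `(∞^∞)`, `l = (l₀ : ℕ∞)` gives `(∞^l₀)`).
Throughout, boxes are 0-based: the paper's box `(i, j)` (with row `i ≥ 1` and
column `j ≥ 1`) corresponds to `(i - 1, j - 1)`. -/
def Box (l : ℕ∞) (b : ℕ × ℕ) : Prop := (b.1 : ℕ∞) < l

/-- `T` is an infinite standard Young tableau of the shape given by `Box l`:
entries are positive integers on the shape (and the junk value `0` off the shape),
`T` is a bijection from the boxes of the shape onto the positive integers, and
`T` is strictly increasing along rows and columns. -/
structure IsSYT (l : ℕ∞) (T : ℕ × ℕ → ℕ) : Prop where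
  zero_outside : ∀ b : ℕ × ℕ, ¬ Box l b → T b = 0
  pos : ∀ b : ℕ × ℕ, Box l b → 0 < T b
  inj : ∀ b c : ℕ × ℕ, Box l b → Box l c → T b = T c → b = c
  surj : ∀ n : ℕ, 0 < n → ∃ b : ℕ × ℕ, Box l b ∧ T b = n
  row_lt : ∀ b : ℕ × ℕ, Box l b → T b < T (b.1, b.2 + 1)
  col_lt : ∀ b : ℕ × ℕ, Box l (b.1 + 1, b.2) → T b < T (b.1 + 1, b.2)

/-- The sliding path of the filling `T` inside the set `D` of boxes, started at the
box `c`: at each step the empty box moves to whichever of the boxes directly below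
or directly to the right (among those belonging to `D`) carries the smaller entry;
if neither belongs to `D`, the path stays put (it has terminated). -/
noncomputable def slideFrom (D : ℕ × ℕ → Prop) (T : ℕ × ℕ → ℕ) (c : ℕ × ℕ) : ℕ → ℕ × ℕ
  | 0 => c
  | n + 1 =>
      let b := slideFrom D T c n
      if D (b.1 + 1, b.2) ∧ D (b.1, b.2 + 1) then
        (if T (b.1 + 1, b.2) < T (b.1, b.2 + 1) then (b.1 + 1, b.2) else (b.1, b.2 + 1))
      else if D (b.1 + 1, b.2) then (b.1 + 1, b.2)
      else if D (b.1, b.2 + 1) then (b.1, b.2 + 1)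
      else b

/-- The sliding path `p(T)`, 0-indexed: `slide D T n` is the paper's `p_{n+1}(T)`;
it lies on the antidiagonal `i + j = n` as long as the path has not terminated. -/
noncomputable def slide (D : ℕ × ℕ → Prop) (T : ℕ × ℕ → ℕ) : ℕ → ℕ × ℕ :=
  slideFrom D T (0, 0)

/-- Jeu de taquin on the set of boxes `D`: the entry `1` in the box `(0,0)` is
deleted, entries slide backwards along the sliding path, and every entry is
decremented by `1`.  A box `b` lies on the sliding path iff
`slide D T (b.1 + b.2) = b`; if moreover the path terminates at `b` (which is only
possible for finite tableaux) the box `b` is vacated (junk value `0`). -/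
noncomputable def jdt (D : ℕ × ℕ → Prop) (T : ℕ × ℕ → ℕ) : ℕ × ℕ → ℕ := fun b =>
  if slide D T (b.1 + b.2) = b then
    (if slide D T (b.1 + b.2 + 1) = b then 0
     else T (slide D T (b.1 + b.2 + 1)) - 1)
  else T b - 1

/-- A 0-based box of the Young diagram of the partition with row lengths `lam`. -/
def YBox (lam : ℕ → ℕ) (b : ℕ × ℕ) : Prop := b.2 < lam b.1

/-- `lam : ℕ → ℕ` (0-based row lengths) is a partition of `n`. -/
structure IsPartition (lam : ℕ → ℕ) (n : ℕ) : Prop where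
  antitone : ∀ i : ℕ, lam (i + 1) ≤ lam i
  finite : {b : ℕ × ℕ | YBox lam b}.Finite
  card : {b : ℕ × ℕ | YBox lam b}.ncard = n

/-- `S` is a (finite) standard Young tableau of shape `lam` with `n` boxes:
a filling of the diagram of `lam` by `1, …, n` (with junk value `0` off the
diagram), strictly increasing along rows and columns. -/
structure IsFinSYT (lam : ℕ → ℕ) (n : ℕ) (S : ℕ × ℕ → ℕ) : Prop where
  zero_outside : ∀ b : ℕ × ℕ, ¬ YBox lam b → S b = 0
  lb : ∀ b : ℕ × ℕ, YBox lam b → 1 ≤ S b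
  ub : ∀ b : ℕ × ℕ, YBox lam b → S b ≤ n
  inj : ∀ b c : ℕ × ℕ, YBox lam b → YBox lam c → S b = S c → b = c
  surj : ∀ m : ℕ, 1 ≤ m → m ≤ n → ∃ b : ℕ × ℕ, YBox lam b ∧ S b = m
  row_lt : ∀ b : ℕ × ℕ, YBox lam (b.1, b.2 + 1) → S b < S (b.1, b.2 + 1)
  col_lt : ∀ b : ℕ × ℕ, YBox lam (b.1 + 1, b.2) → S b < S (b.1 + 1, b.2)

/-- The metric `d(T, U) = Σ_{(i,j) : T_{i,j} ≠ U_{i,j}} 2^{-(i+j)}` (1-based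
indices in the exponent, so the 0-based box `b` contributes `2^{-(b.1+b.2+2)}`). -/
noncomputable def dSYT (T U : ℕ × ℕ → ℕ) : ℝ :=
  ∑' b : ℕ × ℕ, if T b ≠ U b then ((2 : ℝ) ^ (b.1 + b.2 + 2))⁻¹ else 0

/-- `V` is an open subset of `SYT((∞^l))` for the topology induced by the metric
`dSYT`. -/
def IsOpenSYT (l : ℕ∞) (V : Set (ℕ × ℕ → ℕ)) : Prop :=
  (∀ T ∈ V, IsSYT l T) ∧
  ∀ T ∈ V, ∃ ε : ℝ, 0 < ε ∧ ∀ U : ℕ × ℕ → ℕ, IsSYT l U → dSYT T U < ε → U ∈ V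

def nxt (l : ℕ) (T : ℕ × ℕ → ℕ) (b : ℕ × ℕ) : ℕ × ℕ :=
  if b.1 + 1 < l ∧ T (b.1 + 1, b.2) < T (b.1, b.2 + 1) then (b.1 + 1, b.2) else (b.1, b.2 + 1)

theorem box_iff (l : ℕ) (b : ℕ × ℕ) : Box (l : ℕ∞) b ↔ b.1 < l := by simp [Box]

theorem slide_step (l : ℕ) (T : ℕ × ℕ → ℕ) (n : ℕ)
    (h : (slide (Box (l : ℕ∞)) T n).1 < l) :
    slide (Box (l : ℕ∞)) T (n + 1) = nxt l T (slide (Box (l : ℕ∞)) T n) := by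
  unfold slide at *
  rw [slideFrom]
  simp only [box_iff, nxt]
  split_ifs <;> first | rfl | (exfalso; tauto)

theorem slide_spec (l : ℕ) (hl : 1 ≤ l) (T : ℕ × ℕ → ℕ) (n : ℕ) :
    (slide (Box (l : ℕ∞)) T n).1 < l ∧
    (slide (Box (l : ℕ∞)) T n).1 + (slide (Box (l : ℕ∞)) T n).2 = n := by
  induction n with
  | zero => simp [slide, slideFrom]; omega
  | succ n ih =>
    rw [slide_step l T n ih.1]
    unfold nxt
    split_ifs <;> simp <;> omega

theorem slide_zero (l : ℕ) (T : ℕ × ℕ → ℕ) : slide (Box (l : ℕ∞)) T 0 = (0, 0) := rfl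

theorem slide_succ (l : ℕ) (hl : 1 ≤ l) (T : ℕ × ℕ → ℕ) (n : ℕ) :
    slide (Box (l : ℕ∞)) T (n + 1) = nxt l T (slide (Box (l : ℕ∞)) T n) :=
  slide_step l T n (slide_spec l hl T n).1

/-- The box whose entry moves to `b`. -/
noncomputable def src (l : ℕ) (T : ℕ × ℕ → ℕ) (b : ℕ × ℕ) : ℕ × ℕ :=
  if slide (Box (l : ℕ∞)) T (b.1 + b.2) = b then nxt l T b else b

theorem nxt_ne (l : ℕ) (T : ℕ × ℕ → ℕ) (b : ℕ × ℕ) : nxt l T b ≠ b := by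
  obtain ⟨i, j⟩ := b
  unfold nxt
  split_ifs <;> simp

theorem jdt_eq (l : ℕ) (hl : 1 ≤ l) (T : ℕ × ℕ → ℕ) (b : ℕ × ℕ) :
    jdt (Box (l : ℕ∞)) T b = T (src l T b) - 1 := by
  unfold jdt src
  rw [slide_succ l hl]
  by_cases h : slide (Box (l : ℕ∞)) T (b.1 + b.2) = b
  · rw [if_pos h, if_pos h, h, if_neg (nxt_ne l T b)]
  · rw [if_neg h, if_neg h]

theorem nxt_row (l : ℕ) (T : ℕ × ℕ → ℕ) (b : ℕ × ℕ) (h : b.1 < l) : (nxt l T b).1 < l := by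
  unfold nxt; split_ifs <;> simp <;> omega

theorem nxt_sum (l : ℕ) (T : ℕ × ℕ → ℕ) (b : ℕ × ℕ) :
    (nxt l T b).1 + (nxt l T b).2 = b.1 + b.2 + 1 := by
  unfold nxt; split_ifs <;> simp <;> omega

section syt
variable {l : ℕ} {T : ℕ × ℕ → ℕ}

theorem lt_nxt (hT : IsSYT (l : ℕ∞) T) (b : ℕ × ℕ) (h : b.1 < l) : T b < T (nxt l T b) := by
  unfold nxt
  split_ifs with h1
  · exact hT.col_lt b ((box_iff _ _).2 h1.1)
  · exact hT.row_lt b ((box_iff _ _).2 h)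

theorem row_mono (hT : IsSYT (l : ℕ∞) T) (i : ℕ) (h : i < l) : StrictMono fun j => T (i, j) :=
  strictMono_nat_of_lt_succ fun j => hT.row_lt (i, j) ((box_iff _ _).2 h)

theorem one_iff (hT : IsSYT (l : ℕ∞) T) (b : ℕ × ℕ) (h : b.1 < l) (hb : b ≠ (0, 0)) :
    1 < T b := by
  obtain ⟨i, j⟩ := b
  rcases i with _ | i
  · rcases j with _ | j
    · simp at hb
    · have := hT.row_lt (0, j) ((box_iff _ _).2 h)
      have := hT.pos (0, j) ((box_iff _ _).2 h)
      simp at *; omega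
  · have := hT.col_lt (i, j) ((box_iff _ _).2 h)
    have := hT.pos (i, j) ((box_iff _ _).2 (by simp at *; omega))
    simp at *; omega

theorem src_row (b : ℕ × ℕ) (h : b.1 < l) : (src l T b).1 < l := by
  unfold src; split_ifs
  · exact nxt_row l T b h
  · exact h

theorem le_src (hT : IsSYT (l : ℕ∞) T) (b : ℕ × ℕ) (h : b.1 < l) : T b ≤ T (src l T b) := by
  unfold src; split_ifs
  · exact (lt_nxt hT b h).le
  · exact le_rfl

theorem src_ne (b : ℕ × ℕ) : src l T b ≠ (0, 0) := by
  unfold src; split_ifs with h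
  · intro h1
    have := nxt_sum l T b
    rw [h1] at this; simp at this
  · rintro rfl
    exact h rfl

/-- Generic comparison: `c` is a neighbour of `b`. -/
theorem src_lt (hl : 1 ≤ l) (hT : IsSYT (l : ℕ∞) T) (b c : ℕ × ℕ) (hb : b.1 < l) (hc : c.1 < l)
    (hbc : T b < T c) (hs : c.1 + c.2 = b.1 + b.2 + 1) (hn : T (nxt l T b) ≤ T c) :
    T (src l T b) < T (src l T c) := by
  have h1 := lt_nxt hT c hc
  unfold src
  rw [hs, slide_succ l hl]
  by_cases h : slide (Box (l : ℕ∞)) T (b.1 + b.2) = b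
  · rw [if_pos h, h]
    split_ifs with h2
    · omega
    · refine lt_of_le_of_ne hn fun h3 => h2 ?_
      exact hT.inj _ _ ((box_iff _ _).2 (nxt_row l T b hb)) ((box_iff _ _).2 hc) h3
  · rw [if_neg h]
    split_ifs <;> omega

theorem src_inj (hl : 1 ≤ l) (b c : ℕ × ℕ) 
    (h : src l T b = src l T c) : b = c := by
  have key : ∀ b c : ℕ × ℕ, slide (Box (l : ℕ∞)) T (b.1 + b.2) = b →
      ¬ slide (Box (l : ℕ∞)) T (c.1 + c.2) = c → nxt l T b = c → False := by
    intro b c h1 h2 h3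
    have := nxt_sum l T b
    rw [h3] at this
    rw [this, slide_succ l hl, h1] at h2
    exact h2 h3
  unfold src at h
  split_ifs at h with h1 h2 h2
  · have e1 := nxt_sum l T b
    have e2 := nxt_sum l T c
    rw [h] at e1
    have : b.1 + b.2 = c.1 + c.2 := by omega
    rw [← h1, ← h2, this]
  · exact (key b c h1 h2 h).elim
  · exact (key c b h2 h1 h.symm).elim
  · exact h

theorem src_surj (hl : 1 ≤ l) (c : ℕ × ℕ) (hc : c.1 < l) (h0 : c ≠ (0, 0)) :
    ∃ b : ℕ × ℕ, b.1 < l ∧ src l T b = c := by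
  by_cases h : slide (Box (l : ℕ∞)) T (c.1 + c.2) = c
  · obtain ⟨m, hm⟩ : ∃ m, c.1 + c.2 = m + 1 := by
      obtain ⟨i, j⟩ := c
      refine ⟨i + j - 1, ?_⟩
      simp at h0 ⊢
      omega
    rw [hm, slide_succ l hl] at h
    have hs := slide_spec l hl T m
    refine ⟨slide (Box (l : ℕ∞)) T m, hs.1, ?_⟩
    unfold src
    rw [hs.2, if_pos rfl, h]
  · exact ⟨c, hc, by unfold src; rw [if_neg h]⟩

theorem jdt_syt (hl : 1 ≤ l) (hT : IsSYT (l : ℕ∞) T) : IsSYT (l : ℕ∞) (jdt (Box (l : ℕ∞)) T) := by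
  have big : ∀ b : ℕ × ℕ, b.1 < l → 1 < T (src l T b) := fun b hb =>
    one_iff hT _ (src_row b hb) (src_ne b)
  constructor
  · intro b hb
    rw [jdt_eq l hl]
    have : src l T b = b := by
      unfold src
      rw [if_neg]
      intro h
      apply hb
      rw [box_iff, ← h]
      exact (slide_spec l hl T _).1
    rw [this, hT.zero_outside b hb]
  · intro b hb
    rw [jdt_eq l hl]
    have := big b ((box_iff _ _).1 hb)
    omega
  · intro b c hb hc h
    rw [box_iff] at hb hc
    rw [jdt_eq l hl, jdt_eq l hl] at h
    have := big b hb
    have := big c hc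
    apply src_inj (T := T) hl b c
    exact hT.inj _ _ ((box_iff _ _).2 (src_row b hb)) ((box_iff _ _).2 (src_row c hc)) (by omega)
  · intro n hn
    obtain ⟨c, hc, hcn⟩ := hT.surj (n + 1) (by omega)
    obtain ⟨z, hz, hz1⟩ := hT.surj 1 (by omega)
    have h0 : c ≠ (0, 0) := by
      rintro rfl
      by_cases hz0 : z = (0, 0)
      · subst hz0; omega
      · have := one_iff hT z ((box_iff _ _).1 hz) hz0
        omega
    obtain ⟨b, hb, hbc⟩ := src_surj (T := T) hl c ((box_iff _ _).1 hc) h0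
    refine ⟨b, (box_iff _ _).2 hb, ?_⟩
    rw [jdt_eq l hl, hbc, hcn]; rfl
  · intro b hb
    have hlt := hT.row_lt b hb
    rw [box_iff] at hb
    rw [jdt_eq l hl, jdt_eq l hl]
    have := src_lt hl hT b (b.1, b.2 + 1) hb hb hlt (by simp; omega) (by
      unfold nxt; split_ifs with h
      · exact h.2.le
      · exact le_rfl)
    have := big b hb
    omega
  · intro b hb
    have hlt := hT.col_lt b hb
    rw [box_iff] at hb
    have hb0 : b.1 < l := by simp at hb; omega
    rw [jdt_eq l hl, jdt_eq l hl]
    have := src_lt hl hT b (b.1 + 1, b.2) hb0 hb hlt (by simp; omega) (by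
      unfold nxt; split_ifs with h
      · exact le_rfl
      · simp at h hb
        exact h hb)
    have := big b hb0
    omega

theorem iter_syt (hl : 1 ≤ l) (k : ℕ) : ∀ T : ℕ × ℕ → ℕ, IsSYT (l : ℕ∞) T →
    IsSYT (l : ℕ∞) ((jdt (Box (l : ℕ∞)))^[k] T) := by
  induction k with
  | zero => intro T hT; exact hT
  | succ k ih => intro T hT; rw [Function.iterate_succ_apply]; exact ih _ (jdt_syt hl hT)

theorem region {U : ℕ × ℕ → ℕ} (hT : IsSYT (l : ℕ∞) T) (hU : IsSYT (l : ℕ∞) U) (k : ℕ) (μ : ℕ → ℕ)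
    (h : ∀ i j, i < l → T (i, μ i + j) = U (i, j) + k) (b : ℕ × ℕ) (hb : b.1 < l) :
    k < T b ↔ μ b.1 ≤ b.2 := by
  constructor
  · intro hk
    obtain ⟨c, hc, hcn⟩ := hU.surj (T b - k) (by omega)
    have e := h c.1 c.2 ((box_iff _ _).1 hc)
    have := hT.inj b (c.1, μ c.1 + c.2) ((box_iff _ _).2 hb) hc (by rw [e]; simp; omega)
    rw [this]; simp
  · intro hk
    have e := h b.1 (b.2 - μ b.1) hb
    have := hU.pos (b.1, b.2 - μ b.1) ((box_iff _ _).2 hb)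
    rw [show μ b.1 + (b.2 - μ b.1) = b.2 by omega] at e
    simp at e; omega

theorem step {U : ℕ × ℕ → ℕ} (hl : 1 ≤ l) (hT : IsSYT (l : ℕ∞) T) (hU : IsSYT (l : ℕ∞) U)
    (k : ℕ) (μ : ℕ → ℕ)
    (h : ∀ i j, i < l → T (i, μ i + j) = U (i, j) + (k + 1)) :
    ∃ μ' : ℕ → ℕ, ∀ i j, i < l → jdt (Box (l : ℕ∞)) T (i, μ' i + j) = U (i, j) + k := by
  have hreg := region hT hU (k + 1) μ h
  set p := slide (Box (l : ℕ∞)) T with hp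
  have hspec : ∀ n, (p n).1 < l ∧ (p n).1 + (p n).2 = n := slide_spec l hl T
  have hsucc : ∀ n, p (n + 1) = nxt l T (p n) := slide_succ l hl T
  have hmono : ∀ n, n < T (p n) := by
    intro n
    induction n with
    | zero => exact hT.pos _ ((box_iff _ _).2 (hspec 0).1)
    | succ n ih =>
      have := lt_nxt hT (p n) (hspec n).1
      rw [hsucc]; omega
  have hex : ∃ n, k + 1 < T (p n) := ⟨k + 1, hmono _⟩
  have hp0 : T (p 0) = 1 := by
    obtain ⟨z, hz, hz1⟩ := hT.surj 1 (by omega)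
    by_cases hz0 : z = (0, 0)
    · subst hz0; exact hz1
    · have := one_iff hT z ((box_iff _ _).1 hz) hz0
      omega
  obtain ⟨n, hn1, hn2⟩ : ∃ n, T (p n) ≤ k + 1 ∧ k + 1 < T (p (n + 1)) := by
    have hs := Nat.find_spec hex
    have hm := fun m => Nat.find_min hex (m := m)
    set N := Nat.find hex
    rcases hN : N with _ | n
    · rw [hN] at hs; omega
    · rw [hN] at hs hm
      exact ⟨n, not_lt.1 (hm n (by omega)), hs⟩
  rcases hrc : p n with ⟨r, c⟩
  have hr : r < l := by have := (hspec n).1; rw [hrc] at this; exact this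
  have hrcn : r + c = n := by have := (hspec n).2; rw [hrc] at this; exact this
  rw [hrc] at hn1
  rw [hsucc, hrc] at hn2
  have hc1 : c < μ r := by
    have := hreg (r, c) hr
    simp at this; omega
  have hbig : k + 1 < T (r, c + 1) ∧ (r + 1 < l → k + 1 < T (r + 1, c)) := by
    unfold nxt at hn2
    simp only at hn2
    split_ifs at hn2 with h1
    · exact ⟨by omega, fun _ => hn2⟩
    · refine ⟨hn2, fun h2 => ?_⟩
      have : ¬ T (r + 1, c) < T (r, c + 1) := fun h3 => h1 ⟨h2, h3⟩
      omega
  have hc2 : μ r = c + 1 := by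
    have := (hreg (r, c + 1) hr).1 hbig.1
    simp at this; omega
  have hc3 : r + 1 < l → μ (r + 1) ≤ c := fun h2 => by
    simpa using (hreg (r + 1, c) h2).1 (hbig.2 h2)
  have hpath : ∀ j, p (n + j) = (r, c + j) := by
    intro j
    induction j with
    | zero => simpa using hrc
    | succ j ih =>
      rw [← add_assoc, hsucc, ih]
      unfold nxt
      rw [if_neg]
      · rfl
      · rintro ⟨h1, h2⟩
        simp only at h1 h2
        have e1 := h r j hr
        have e2 := h (r + 1) (c + j - μ (r + 1)) h1
        have h3 := hc3 h1
        rw [show μ (r + 1) + (c + j - μ (r + 1)) = c + j by omega] at e2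
        rw [show μ r + j = c + j + 1 by omega] at e1
        have h4 := hU.col_lt (r, j) ((box_iff _ _).2 h1)
        have h5 := (row_mono hU (r + 1) h1).monotone (show j ≤ c + j - μ (r + 1) by omega)
        simp only at h4 h5
        omega
  refine ⟨fun i => if i = r then c else μ i, fun i j hi => ?_⟩
  rw [jdt_eq l hl]
  by_cases hir : i = r
  · subst hir
    have : src l T (i, c + j) = (i, c + (j + 1)) := by
      unfold src
      simp only
      rw [← hp, show i + (c + j) = n + j by omega, hpath, if_pos rfl, ← hpath, ← hpath (j + 1),
        ← add_assoc, hsucc]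
    simp only [if_true]
    rw [this, show c + (j + 1) = μ i + j by omega, h i j hi]
    rfl
  · have : src l T (i, μ i + j) = (i, μ i + j) := by
      unfold src
      simp only
      rw [← hp, if_neg]
      intro h1
      have h2 : k + 1 < T (p (i + (μ i + j))) := by
        rw [h1]; exact (hreg (i, μ i + j) hi).2 (by simp)
      have : n ≤ i + (μ i + j) := by
        by_contra h3
        have hmon : StrictMono fun m => T (p m) := strictMono_nat_of_lt_succ fun m => by
          rw [hsucc]; exact lt_nxt hT _ (hspec m).1
        have h4 := hmon (not_le.1 h3)
        simp only [hrc] at h4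
        omega
      obtain ⟨t, ht⟩ := Nat.exists_eq_add_of_le this
      rw [ht, hpath] at h1
      exact hir (by simpa using (congrArg Prod.fst h1).symm)
    simp only [if_neg hir]
    rw [this, h i j hi]
    rfl

theorem iter_eq {U : ℕ × ℕ → ℕ} (hl : 1 ≤ l) (hU : IsSYT (l : ℕ∞) U) (k : ℕ) :
    ∀ (T : ℕ × ℕ → ℕ) (μ : ℕ → ℕ), IsSYT (l : ℕ∞) T →
    (∀ i j, i < l → T (i, μ i + j) = U (i, j) + k) → (jdt (Box (l : ℕ∞)))^[k] T = U := by
  induction k with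
  | zero =>
    intro T μ hT h
    have hreg := region hT hU 0 μ h
    funext b
    obtain ⟨i, j⟩ := b
    by_cases hi : i < l
    · have h1 := (hreg (i, 0) hi).1 (hT.pos _ ((box_iff _ _).2 hi))
      have h2 := h i j hi
      have h3 : μ i = 0 := by simpa using h1
      simpa [h3] using h2
    · have : ¬ Box (l : ℕ∞) (i, j) := fun h => hi ((box_iff _ _).1 h)
      simp [hT.zero_outside _ this, hU.zero_outside _ this]
  | succ k ih =>
    intro T μ hT h
    obtain ⟨μ', h'⟩ := step hl hT hU k μ h
    rw [Function.iterate_succ_apply]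
    exact ih _ μ' (jdt_syt hl hT) h'

end syt

/-- Finite tableau with at most `l` rows. -/
structure Piece (l n : ℕ) (lam : ℕ → ℕ) (S : ℕ × ℕ → ℕ) : Prop where
  anti : ∀ i : ℕ, lam (i + 1) ≤ lam i
  rows : ∀ i : ℕ, l ≤ i → lam i = 0
  fin : IsFinSYT lam n S

/-- Extend by a column so that all rows are nonempty. -/
theorem piece_extend {l n : ℕ} {lam : ℕ → ℕ} {S : ℕ × ℕ → ℕ} (h : Piece l n lam S) :
    ∃ (n' : ℕ) (lam' : ℕ → ℕ) (S' : ℕ × ℕ → ℕ), Piece l n' lam' S' ∧ (∀ i < l, 0 < lam' i) ∧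
      ∀ b, YBox lam b → YBox lam' b ∧ S' b = S b := by
  obtain ⟨ha, hr, hf⟩ := h
  have mem : ∀ i j, j < lam i → i < l := fun i j hj => by
    by_contra hi
    have := hr i (by omega)
    omega
  refine ⟨n + l, fun i => if i < l then lam i + 1 else 0,
    fun b => if b.2 < lam b.1 then S b else if b.1 < l ∧ b.2 = lam b.1 then n + b.1 + 1 else 0,
    ⟨?_, ?_, ?_⟩, ?_, ?_⟩
  · intro i
    have := ha i
    split_ifs <;> omega
  · intro i hi
    rw [if_neg (by omega)]
  · constructor
    · rintro ⟨i, j⟩ hb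
      have := mem i j
      simp only [YBox] at *
      split_ifs at * <;> omega
    · rintro ⟨i, j⟩ hb
      have := mem i j
      have := hf.lb (i, j)
      simp only [YBox] at *
      split_ifs at * <;> omega
    · rintro ⟨i, j⟩ hb
      have := mem i j
      have := hf.ub (i, j)
      simp only [YBox] at *
      split_ifs at * <;> omega
    · rintro ⟨i, j⟩ ⟨i', j'⟩ hb hc e
      have := hf.ub (i, j)
      have := hf.ub (i', j')
      have h3 := hf.inj (i, j) (i', j')
      simp only [YBox, Prod.mk.injEq] at *
      split_ifs at * with h1 h2 h4 h5 h6 <;> first | omega | skip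
      have : i = i' := by omega
      subst this
      omega
    · intro m h1 h2
      by_cases hm : m ≤ n
      · obtain ⟨⟨i, j⟩, hb, e⟩ := hf.surj m h1 hm
        refine ⟨(i, j), ?_, ?_⟩
        · simp only [YBox] at *
          rw [if_pos (mem i j hb)]; omega
        · simp only [YBox] at *
          rw [if_pos hb, e]
      · refine ⟨(m - n - 1, lam (m - n - 1)), ?_, ?_⟩
        · simp only [YBox]
          rw [if_pos (by omega)]; omega
        · simp only
          rw [if_neg (by omega), if_pos (by refine ⟨by omega, by simp⟩)]
          omega
    · rintro ⟨i, j⟩ hb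
      have := hf.row_lt (i, j)
      have := hf.ub (i, j)
      have := mem i j
      simp only [YBox] at *
      split_ifs at * <;> omega
    · rintro ⟨i, j⟩ hb
      have := hf.col_lt (i, j)
      have := hf.ub (i, j)
      have := mem i j
      have := ha i
      simp only [YBox] at *
      split_ifs at * <;> omega
  · intro i hi
    simp only [if_pos hi]; omega
  · rintro ⟨i, j⟩ hb
    have := mem i j hb
    simp only [YBox] at *
    rw [if_pos this, if_pos hb]
    exact ⟨by omega, rfl⟩

theorem truncate {l : ℕ} {T : ℕ × ℕ → ℕ} (hT : IsSYT (l : ℕ∞) T) (N : ℕ) :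
    ∃ (lam : ℕ → ℕ) (S : ℕ × ℕ → ℕ), Piece l N lam S ∧
      ∀ b : ℕ × ℕ, b.1 < l → T b ≤ N → YBox lam b ∧ S b = T b := by
  have h1 : ∀ i, ∃ m, ∀ j, j < m ↔ i < l ∧ T (i, j) ≤ N := by
    intro i
    by_cases hi : i < l
    · have hm := row_mono hT i hi
      have hex : ∃ j, N < T (i, j) := ⟨N + 1, lt_of_lt_of_le (Nat.lt_succ_self N) (hm.id_le (N + 1))⟩
      refine ⟨Nat.find hex, fun j => ?_⟩
      rw [Nat.lt_find_iff]
      constructor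
      · intro h; exact ⟨hi, not_lt.1 (h j le_rfl)⟩
      · rintro ⟨_, h⟩ m hmj
        have := hm.monotone hmj
        omega
    · exact ⟨0, fun j => by simp [hi]⟩
  choose lam hlam using h1
  have hY : ∀ b, YBox lam b ↔ b.1 < l ∧ T b ≤ N := fun b => hlam b.1 b.2
  have hmem : ∀ b : ℕ × ℕ, b.1 < l ∧ T b ≤ N → Box (l : ℕ∞) b := fun b h => (box_iff _ _).2 h.1
  refine ⟨lam, fun b => if YBox lam b then T b else 0, ⟨?_, ?_, ?_⟩, ?_⟩
  · intro i
    by_contra h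
    have h2 := (hlam (i + 1) (lam i)).1 (by omega)
    have h3 := hT.col_lt (i, lam i) ((box_iff _ _).2 h2.1)
    have h4 := (hlam i (lam i)).2 ⟨by omega, by simp only at h3; omega⟩
    omega
  · intro i hi
    by_contra h
    have h2 := (hlam i 0).1 (by omega)
    omega
  · constructor
    · intro b hb; rw [if_neg hb]
    · intro b hb; rw [if_pos hb]; exact hT.pos b (hmem b ((hY b).1 hb))
    · intro b hb; rw [if_pos hb]; exact ((hY b).1 hb).2
    · intro b c hb hc e
      rw [if_pos hb, if_pos hc] at e
      exact hT.inj b c (hmem b ((hY b).1 hb)) (hmem c ((hY c).1 hc)) e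
    · intro m hm1 hm2
      obtain ⟨b, hb, e⟩ := hT.surj m hm1
      have : YBox lam b := (hY b).2 ⟨(box_iff _ _).1 hb, by omega⟩
      exact ⟨b, this, by rw [if_pos this, e]⟩
    · intro b hb
      have h2 := (hY _).1 hb
      have h3 := hT.row_lt b ((box_iff _ _).2 h2.1)
      rw [if_pos hb, if_pos ((hY b).2 ⟨h2.1, by omega⟩)]
      exact h3
    · intro b hb
      have h2 := (hY _).1 hb
      have h3 := hT.col_lt b ((box_iff _ _).2 h2.1)
      have h4 : b.1 < l := by have := h2.1; simp only at this; omega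
      rw [if_pos hb, if_pos ((hY b).2 ⟨h4, by omega⟩)]
      exact h3
  · intro b hb hbN
    have := (hY b).2 ⟨hb, hbN⟩
    exact ⟨this, by simp only [if_pos this]⟩

/-- Infinite concatenation of finite tableaux, starting from index `m`. -/
def cat (n : ℕ → ℕ) (lam : ℕ → ℕ → ℕ) (S : ℕ → ℕ × ℕ → ℕ) (m i j : ℕ) : ℕ :=
  if j < lam m i then S m (i, j)
  else if lam m i = 0 then 0
  else cat n lam S (m + 1) i (j - lam m i) + n m
termination_by j
decreasing_by omega

section cat
variable {l : ℕ} {n : ℕ → ℕ} {lam : ℕ → ℕ → ℕ} {S : ℕ → ℕ × ℕ → ℕ}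

theorem cat_lt {m i j : ℕ} (h : j < lam m i) : cat n lam S m i j = S m (i, j) := by
  rw [cat, if_pos h]

theorem cat_ge {m i j : ℕ} (h : lam m i ≤ j) (h0 : 0 < lam m i) :
    cat n lam S m i j = cat n lam S (m + 1) i (j - lam m i) + n m := by
  rw [cat, if_neg (by omega), if_neg (by omega)]

theorem cat_pos (hP : ∀ m, Piece l (n m) (lam m) (S m)) (h0 : ∀ m, ∀ i < l, 0 < lam m i)
    (i : ℕ) (hi : i < l) (j : ℕ) : ∀ m, 0 < cat n lam S m i j := by
  induction j using Nat.strong_induction_on with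
  | _ j ih =>
    intro m
    have hm := h0 m i hi
    by_cases h : j < lam m i
    · rw [cat_lt h]; exact (hP m).fin.lb (i, j) h
    · rw [cat_ge (by omega) hm]
      have := ih (j - lam m i) (by omega) (m + 1)
      omega

theorem cat_row (hP : ∀ m, Piece l (n m) (lam m) (S m)) (h0 : ∀ m, ∀ i < l, 0 < lam m i)
    (i : ℕ) (hi : i < l) (j : ℕ) : ∀ m, cat n lam S m i j < cat n lam S m i (j + 1) := by
  induction j using Nat.strong_induction_on with
  | _ j ih =>
    intro m
    have hm := h0 m i hi
    by_cases h : j + 1 < lam m i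
    · rw [cat_lt h, cat_lt (by omega)]; exact (hP m).fin.row_lt (i, j) h
    · rw [cat_ge (j := j + 1) (by omega) hm]
      by_cases h' : j < lam m i
      · rw [cat_lt h']
        have := (hP m).fin.ub (i, j) h'
        have := cat_pos hP h0 i hi (j + 1 - lam m i) (m + 1)
        omega
      · rw [cat_ge (by omega) hm]
        have := ih (j - lam m i) (by omega) (m + 1)
        rw [show j - lam m i + 1 = j + 1 - lam m i by omega] at this
        omega

theorem cat_col (hP : ∀ m, Piece l (n m) (lam m) (S m)) (h0 : ∀ m, ∀ i < l, 0 < lam m i)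
    (i : ℕ) (hi : i + 1 < l) (j : ℕ) : ∀ m, cat n lam S m i j < cat n lam S m (i + 1) j := by
  induction j using Nat.strong_induction_on with
  | _ j ih =>
    intro m
    have hm := h0 m i (by omega)
    have hm1 := h0 m (i + 1) hi
    have ha := (hP m).anti i
    by_cases h : j < lam m (i + 1)
    · rw [cat_lt h, cat_lt (by omega)]; exact (hP m).fin.col_lt (i, j) h
    · rw [cat_ge (i := i + 1) (by omega) hm1]
      by_cases h' : j < lam m i
      · rw [cat_lt h']
        have := (hP m).fin.ub (i, j) h'
        have := cat_pos hP h0 (i + 1) hi (j - lam m (i + 1)) (m + 1)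
        omega
      · rw [cat_ge (by omega) hm]
        have := ih (j - lam m i) (by omega) (m + 1)
        have h3 := (strictMono_nat_of_lt_succ
          (fun j => cat_row hP h0 (i + 1) hi j (m + 1))).monotone
          (show j - lam m i ≤ j - lam m (i + 1) by omega)
        omega

theorem cat_inj (hP : ∀ m, Piece l (n m) (lam m) (S m)) (h0 : ∀ m, ∀ i < l, 0 < lam m i)
    (i i' : ℕ) (hi : i < l) (hi' : i' < l) (j : ℕ) : ∀ j' m,
    cat n lam S m i j = cat n lam S m i' j' → i = i' ∧ j = j' := by
  induction j using Nat.strong_induction_on with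
  | _ j ih =>
    intro j' m e
    have hm := h0 m i hi
    have hm' := h0 m i' hi'
    by_cases h : j < lam m i <;> by_cases h' : j' < lam m i'
    · rw [cat_lt h, cat_lt h'] at e
      simpa using (hP m).fin.inj (i, j) (i', j') h h' e
    · rw [cat_lt h, cat_ge (by omega) hm'] at e
      have := (hP m).fin.ub (i, j) h
      have := cat_pos hP h0 i' hi' (j' - lam m i') (m + 1)
      omega
    · rw [cat_lt h', cat_ge (by omega) hm] at e
      have := (hP m).fin.ub (i', j') h'
      have := cat_pos hP h0 i hi (j - lam m i) (m + 1)
      omega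
    · rw [cat_ge (by omega) hm, cat_ge (by omega) hm'] at e
      obtain ⟨rfl, h2⟩ := ih (j - lam m i) (by omega) (j' - lam m i') (m + 1) (by omega)
      exact ⟨rfl, by omega⟩

theorem piece_pos (hl : 1 ≤ l) (hP : ∀ m, Piece l (n m) (lam m) (S m))
    (h0 : ∀ m, ∀ i < l, 0 < lam m i) (m : ℕ) : 0 < n m := by
  have h := h0 m 0 hl
  have := (hP m).fin.lb (0, 0) h
  have := (hP m).fin.ub (0, 0) h
  omega

theorem cat_surj (hl : 1 ≤ l) (hP : ∀ m, Piece l (n m) (lam m) (S m))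
    (h0 : ∀ m, ∀ i < l, 0 < lam m i) (v : ℕ) :
    ∀ m, 0 < v → ∃ i j, i < l ∧ cat n lam S m i j = v := by
  induction v using Nat.strong_induction_on with
  | _ v ih =>
    intro m hv
    by_cases h : v ≤ n m
    · obtain ⟨⟨i, j⟩, hb, e⟩ := (hP m).fin.surj v hv h
      refine ⟨i, j, ?_, ?_⟩
      · by_contra hi
        have := (hP m).rows i (by omega)
        simp only [YBox] at hb
        omega
      · rw [cat_lt hb, e]
    · have := piece_pos hl hP h0 m
      obtain ⟨i, j, hi, e⟩ := ih (v - n m) (by omega) (m + 1) (by omega)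
      refine ⟨i, j + lam m i, hi, ?_⟩
      rw [cat_ge (by omega) (h0 m i hi), Nat.add_sub_cancel, e]
      omega

theorem cat_syt (hl : 1 ≤ l) (hP : ∀ m, Piece l (n m) (lam m) (S m))
    (h0 : ∀ m, ∀ i < l, 0 < lam m i) (m : ℕ) :
    IsSYT (l : ℕ∞) fun b => cat n lam S m b.1 b.2 := by
  constructor
  · intro b hb
    rw [box_iff] at hb
    have := (hP m).rows b.1 (by omega)
    rw [cat, if_neg (by omega), if_pos this]
  · intro b hb
    exact cat_pos hP h0 b.1 ((box_iff _ _).1 hb) b.2 m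
  · intro b c hb hc e
    have := cat_inj hP h0 b.1 c.1 ((box_iff _ _).1 hb) ((box_iff _ _).1 hc) b.2 c.2 m e
    exact Prod.ext this.1 this.2
  · intro v hv
    obtain ⟨i, j, hi, e⟩ := cat_surj hl hP h0 v m hv
    exact ⟨(i, j), (box_iff _ _).2 hi, e⟩
  · intro b hb
    exact cat_row hP h0 b.1 ((box_iff _ _).1 hb) b.2 m
  · intro b hb
    exact cat_col hP h0 b.1 ((box_iff _ _).1 hb) b.2 m

theorem cat_jdt (hl : 1 ≤ l) (hP : ∀ m, Piece l (n m) (lam m) (S m))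
    (h0 : ∀ m, ∀ i < l, 0 < lam m i) (m : ℕ) :
    ∃ k, m ≤ k ∧ (jdt (Box (l : ℕ∞)))^[k] (fun b => cat n lam S 0 b.1 b.2) =
      fun b => cat n lam S m b.1 b.2 := by
  induction m with
  | zero => exact ⟨0, le_rfl, rfl⟩
  | succ m ih =>
    obtain ⟨k, hk, e⟩ := ih
    have := piece_pos hl hP h0 m
    refine ⟨n m + k, by omega, ?_⟩
    rw [Function.iterate_add_apply, e]
    refine iter_eq hl (cat_syt hl hP h0 (m + 1)) (n m) _ (lam m) (cat_syt hl hP h0 m) ?_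
    intro i j hi
    simp only
    rw [cat_ge (by omega) (h0 m i hi), Nat.add_sub_cancel_left]

end cat

theorem exists_seq (l : ℕ) : ∃ (n : ℕ → ℕ) (lam : ℕ → ℕ → ℕ) (S : ℕ → ℕ × ℕ → ℕ),
    (∀ m, Piece l (n m) (lam m) (S m)) ∧ (∀ m, ∀ i < l, 0 < lam m i) ∧
    ∀ n' lam' S', Piece l n' lam' S' → (∀ i < l, 0 < lam' i) →
      ∀ K, ∃ m, K ≤ m ∧ n m = n' ∧ lam m = lam' ∧ S m = S' := by
  let A := {x : ℕ × (ℕ →₀ ℕ) × (ℕ × ℕ →₀ ℕ) //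
    Piece l x.1 x.2.1 x.2.2 ∧ ∀ i < l, 0 < x.2.1 i}
  have toA : ∀ n' lam' S', Piece l n' lam' S' → (∀ i < l, 0 < lam' i) →
      ∃ a : A, a.1.1 = n' ∧ (⇑a.1.2.1 : ℕ → ℕ) = lam' ∧ (⇑a.1.2.2 : ℕ × ℕ → ℕ) = S' := by
    intro n' lam' S' hP h0
    have f1 : (Function.support lam').Finite := (Set.finite_Iio l).subset fun i hi => by
      by_contra h
      exact hi (hP.rows i (by simpa using h))
    have f2 : (Function.support S').Finite := by
      refine Set.Finite.of_finite_image (f := S') ((Set.finite_Iic n').subset ?_) ?_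
      · rintro _ ⟨b, hb, rfl⟩
        by_cases h : YBox lam' b
        · exact hP.fin.ub b h
        · exact (hb (hP.fin.zero_outside b h)).elim
      · intro b hb c hc e
        have hb' : YBox lam' b := by
          by_contra h; exact hb (hP.fin.zero_outside b h)
        have hc' : YBox lam' c := by
          by_contra h; exact hc (hP.fin.zero_outside c h)
        exact hP.fin.inj b c hb' hc' e
    exact ⟨⟨(n', Finsupp.ofSupportFinite lam' f1, Finsupp.ofSupportFinite S' f2), hP, h0⟩,
      rfl, rfl, rfl⟩
  have hne : Nonempty A := by
    have hP : Piece l 0 (fun _ => 0) (fun _ => 0) := by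
      refine ⟨fun _ => le_rfl, fun _ _ => rfl, ?_⟩
      constructor <;> simp [YBox]
      intro m h1 h2; omega
    obtain ⟨n', lam', S', h1, h2, _⟩ := piece_extend hP
    exact ⟨(toA _ _ _ h1 h2).choose⟩
  obtain ⟨g, hg⟩ := exists_surjective_nat (A × ℕ)
  refine ⟨fun m => (g m).1.1.1, fun m => (g m).1.1.2.1, fun m => (g m).1.1.2.2,
    fun m => (g m).1.2.1, fun m => (g m).1.2.2, ?_⟩
  intro n' lam' S' hP h0 K
  obtain ⟨a, h1, h2, h3⟩ := toA n' lam' S' hP h0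
  choose m hm using fun t : ℕ => hg (a, t)
  have hinj : Function.Injective m := fun s t e => by
    have := (hm s).symm.trans ((congrArg g e).trans (hm t))
    exact (Prod.ext_iff.1 this).2
  obtain ⟨_, ⟨t, rfl⟩, ht⟩ := (Set.infinite_range_of_injective hinj).exists_gt K
  exact ⟨m t, ht.le, by simp only [hm]; exact ⟨h1, h2, h3⟩⟩

theorem dense_orbit (l : ℕ) (hl : 1 ≤ l) : ∃ T : ℕ × ℕ → ℕ, IsSYT (l : ℕ∞) T ∧
    ∀ n lam S, Piece l n lam S → ∀ K, ∃ k, K ≤ k ∧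
      ∀ b, YBox lam b → (jdt (Box (l : ℕ∞)))^[k] T b = S b := by
  obtain ⟨n, lam, S, hP, h0, hall⟩ := exists_seq l
  refine ⟨fun b => cat n lam S 0 b.1 b.2, cat_syt hl hP h0 0, ?_⟩
  intro n' lam' S' hP' K
  obtain ⟨n2, lam2, S2, hP2, h02, hext⟩ := piece_extend hP'
  obtain ⟨m, hKm, h1, h2, h3⟩ := hall n2 lam2 S2 hP2 h02 K
  obtain ⟨k, hk, e⟩ := cat_jdt hl hP h0 m
  refine ⟨k, by omega, fun b hb => ?_⟩
  obtain ⟨hb2, e2⟩ := hext b hb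
  rw [e]
  simp only
  rw [cat_lt (by rw [h2]; exact hb2), h3, ← e2]

theorem dist_small (ε : ℝ) (hε : 0 < ε) : ∃ s : Finset (ℕ × ℕ), ∀ T U : ℕ × ℕ → ℕ,
    (∀ b ∈ s, T b = U b) → dSYT T U < ε := by
  let f : ℕ × ℕ → ℝ := fun b => ((2 : ℝ) ^ (b.1 + b.2 + 2))⁻¹
  have hf0 : ∀ b, 0 ≤ f b := fun b => by positivity
  have hg : Summable fun n : ℕ => ((2 : ℝ)⁻¹) ^ n :=
    summable_geometric_of_lt_one (by norm_num) (by norm_num)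
  have hf : Summable f := by
    have := (hg.mul_of_nonneg hg (fun n => by positivity) (fun n => by positivity)).mul_right
      ((2 : ℝ)⁻¹ ^ 2)
    refine this.congr fun b => ?_
    simp only [f]
    rw [← inv_pow, pow_add, pow_add]
  obtain ⟨s, hs⟩ := ((tendsto_order.1 (tendsto_tsum_compl_atTop_zero f)).2 ε hε).exists
  refine ⟨s, fun T U h => lt_of_le_of_lt ?_ hs⟩
  have e : ∑' b : {b // b ∉ s}, f b = ∑' b, Set.indicator {b | b ∉ s} f b :=
    tsum_subtype {b | b ∉ s} f
  rw [e]
  unfold dSYT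
  have hi : Summable (Set.indicator {b | b ∉ s} f) := hf.indicator _
  have hle : ∀ b, (if T b ≠ U b then ((2 : ℝ) ^ (b.1 + b.2 + 2))⁻¹ else 0) ≤
      Set.indicator {b | b ∉ s} f b := by
    intro b
    by_cases hb : b ∈ s
    · simp [hb, h b hb]
    · rw [Set.indicator_of_mem (by simpa using hb)]
      split_ifs
      · exact le_rfl
      · exact hf0 b
  refine Summable.tsum_le_tsum hle (Summable.of_nonneg_of_le ?_ hle hi) hi
  intro b
  split_ifs
  · positivity
  · exact le_rfl

theorem visits (l : ℕ) (T : ℕ × ℕ → ℕ) (hl : 1 ≤ l) (hT : IsSYT (l : ℕ∞) T)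
    (hd : ∀ n lam S, Piece l n lam S → ∀ K, ∃ k, K ≤ k ∧
      ∀ b, YBox lam b → (jdt (Box (l : ℕ∞)))^[k] T b = S b)
    (V : Set (ℕ × ℕ → ℕ)) (hV : IsOpenSYT (l : ℕ∞) V) (hne : V.Nonempty) (K : ℕ) :
    ∃ k, K ≤ k ∧ (jdt (Box (l : ℕ∞)))^[k] T ∈ V := by
  obtain ⟨X, hX⟩ := hne
  obtain ⟨ε, hε, hball⟩ := hV.2 X hX
  obtain ⟨s, hs⟩ := dist_small ε hε
  have hXs := hV.1 X hX
  obtain ⟨lam, S, hP, hag⟩ := truncate hXs (s.sup X)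
  obtain ⟨k, hk, e⟩ := hd _ lam S hP K
  have hY := iter_syt hl k T hT
  refine ⟨k, hk, hball _ hY (hs _ _ fun b hb => ?_)⟩
  by_cases h : b.1 < l
  · obtain ⟨h1, h2⟩ := hag b h (Finset.le_sup hb)
    rw [e b h1, h2]
  · have : ¬ Box (l : ℕ∞) b := fun h' => h ((box_iff _ _).1 h')
    rw [hXs.zero_outside b this, hY.zero_outside b this]

/-- For every `l ≥ 1` there is a tableau `T ∈ SYT((∞^l))` whose jeu de taquin
orbit realizes every finite standard Young tableau with at most `l` rows as a
restriction; in particular, jeu de taquin on `SYT((∞^l))` is topologically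
transitive for the metric `dSYT`. -/
theorem stmt_16 (l : ℕ) (hl : 1 ≤ l) :
    (∃ T : ℕ × ℕ → ℕ, IsSYT (l : ℕ∞) T ∧
      ∀ (n : ℕ) (lam : ℕ → ℕ) (S : ℕ × ℕ → ℕ), 1 ≤ n → IsPartition lam n →
        (∀ i : ℕ, l ≤ i → lam i = 0) → IsFinSYT lam n S →
        ∃ k : ℕ, ∀ b : ℕ × ℕ, YBox lam b → (jdt (Box (l : ℕ∞)))^[k] T b = S b) ∧
    (∀ V W : Set (ℕ × ℕ → ℕ), IsOpenSYT (l : ℕ∞) V → IsOpenSYT (l : ℕ∞) W →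
      V.Nonempty → W.Nonempty →
      ∃ n : ℕ, 1 ≤ n ∧ ∃ x ∈ V, (jdt (Box (l : ℕ∞)))^[n] x ∈ W) := by
  obtain ⟨T, hT, hd⟩ := dense_orbit l hl
  refine ⟨⟨T, hT, ?_⟩, ?_⟩
  · intro n lam S _ hp hr hf
    obtain ⟨k, _, hk⟩ := hd n lam S ⟨hp.antitone, hr, hf⟩ 0
    exact ⟨k, hk⟩
  · intro V W hV hW hVn hWn
    obtain ⟨k1, _, h1⟩ := visits l T hl hT hd V hV hVn 0
    obtain ⟨k2, hk, h2⟩ := visits l T hl hT hd W hW hWn (k1 + 1)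
    refine ⟨k2 - k1, by omega, _, h1, ?_⟩
    rw [← Function.iterate_add_apply, show k2 - k1 + k1 = k2 by omega]
    exact h2
end

section
/- Let l ≥ 1. The set of periodic points of jdt, i.e., { T ∈ SYT((∞^l)) : jdt^k(T) = T for some k ≥ 1 }, is dense in SYT((∞^l)) with respect to the metric d. -/
open scoped Classical

/-- invariant during the iteration -/
structure JInv (l : ℕ) (S : ℕ × ℕ → ℕ) (c : ℕ) (lam : ℕ → ℕ) (V : ℕ × ℕ → ℕ) : Prop where
  anti : ∀ i, i + 1 < l → lam (i + 1) ≤ lam i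
  sum : ∑ i ∈ Finset.range l, lam i = c
  out : ∀ i j, l ≤ i → V (i, j) = 0
  small : ∀ i j, i < l → j < lam i → V (i, j) ≤ c
  big : ∀ i j, i < l → V (i, lam i + j) = S (i, j) + c

theorem slide_succ_s17 (l : ℕ) (V : ℕ × ℕ → ℕ) (n i j : ℕ) (h : slide (Box (l : ℕ∞)) V n = (i, j))
    (hi : i < l) :
    slide (Box (l : ℕ∞)) V (n + 1) =
      if i + 1 < l ∧ V (i + 1, j) < V (i, j + 1) then (i + 1, j) else (i, j + 1) := by
  unfold slide at *
  rw [slideFrom]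
  simp only [h, box_iff]
  by_cases h1 : i + 1 < l <;> simp [h1, hi]

theorem slide_diag (l : ℕ) (hl : 1 ≤ l) (V : ℕ × ℕ → ℕ) (n : ℕ) :
    (slide (Box (l : ℕ∞)) V n).1 < l ∧
      (slide (Box (l : ℕ∞)) V n).1 + (slide (Box (l : ℕ∞)) V n).2 = n := by
  induction n with
  | zero => simp [slide, slideFrom]; omega
  | succ n ih =>
    obtain ⟨h1, h2⟩ := ih
    rcases hs : slide (Box (l : ℕ∞)) V n with ⟨i, j⟩
    rw [hs] at h1 h2
    rw [slide_succ_s17 l V n i j hs h1]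
    split_ifs with h
    · simp at *; omega
    · simp at *; omega

theorem JInv.gt {l : ℕ} {S : ℕ × ℕ → ℕ} {c : ℕ} {lam : ℕ → ℕ} {V : ℕ × ℕ → ℕ}
    (h : JInv l S c lam V) (hS : ∀ i j, i < l → 0 < S (i, j)) (i j : ℕ) (hi : i < l)
    (hj : lam i ≤ j) : c < V (i, j) := by
  obtain ⟨t, rfl⟩ := Nat.exists_eq_add_of_le hj
  rw [h.big i t hi]
  have := hS i t hi
  omega

theorem JInv.path {l : ℕ} (hl : 1 ≤ l) {S : ℕ × ℕ → ℕ} {c : ℕ} {lam : ℕ → ℕ} {V : ℕ × ℕ → ℕ}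
    (h : JInv l S c lam V) (hS : ∀ i j, i < l → 0 < S (i, j)) (hc : 0 < c)
    (hrow : ∀ i j, i < l → S (i, j) < S (i, j + 1))
    (hcol : ∀ i j, i + 1 < l → S (i, j) < S (i + 1, j)) :
    ∃ r, r < l ∧ 0 < lam r ∧ (r + 1 < l → lam (r + 1) < lam r) ∧
      (∀ n, n < r + lam r → (slide (Box (l : ℕ∞)) V n).2 < lam (slide (Box (l : ℕ∞)) V n).1) ∧
      (∀ t, slide (Box (l : ℕ∞)) V (r + lam r - 1 + t) = (r, lam r - 1 + t)) := by
  have hle0 : ∀ i, i < l → lam i ≤ lam 0 := by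
    intro i
    induction i with
    | zero => simp
    | succ i ih => intro hi; exact (h.anti i hi).trans (ih (by omega))
  have h0 : 0 < lam 0 := by
    by_contra h0
    have : ∑ i ∈ Finset.range l, lam i = 0 := by
      apply Finset.sum_eq_zero
      intro i hi
      have := hle0 i (by simpa using hi)
      omega
    have := h.sum
    omega
  have hex : ∃ n, ¬ ((slide (Box (l : ℕ∞)) V n).2 < lam (slide (Box (l : ℕ∞)) V n).1) := by
    refine ⟨l + lam 0, ?_⟩
    obtain ⟨h1, h2⟩ := slide_diag l hl V (l + lam 0)
    have := hle0 _ h1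
    omega
  have hspec := Nat.find_spec hex
  have hmin : ∀ n, n < Nat.find hex → (slide (Box (l : ℕ∞)) V n).2 < lam (slide (Box (l : ℕ∞)) V n).1 :=
    fun n hn => not_not.1 (Nat.find_min hex hn)
  generalize Nat.find hex = F at hspec hmin
  rcases F with _ | N
  · exact absurd (by simpa [slide, slideFrom] using h0) hspec
  obtain ⟨h1, h2⟩ := slide_diag l hl V N
  have h3 := hmin N (by omega)
  rcases hs : slide (Box (l : ℕ∞)) V N with ⟨r, j⟩
  rw [hs] at h1 h2 h3
  simp only at h1 h2 h3
  rw [slide_succ_s17 l V N r j hs h1] at hspec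
  have key : lam r ≤ j + 1 ∧ (r + 1 < l → lam (r + 1) ≤ j) := by
    by_cases hr : r + 1 < l
    · by_cases ha : lam (r + 1) ≤ j
      · refine ⟨?_, fun _ => ha⟩
        by_contra hb
        have e1 := h.gt hS (r + 1) j hr ha
        have e2 := h.small r (j + 1) h1 (by omega)
        rw [if_neg (by omega)] at hspec
        simp at hspec
        omega
      · have e1 := h.small (r + 1) j hr (by omega)
        by_cases hb : lam r ≤ j + 1
        · have e2 := h.gt hS r (j + 1) h1 hb
          rw [if_pos ⟨hr, by omega⟩] at hspec
          simp at hspec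
          omega
        · split_ifs at hspec <;> simp at hspec <;> omega
    · rw [if_neg (by omega)] at hspec
      simp at hspec
      exact ⟨hspec, fun hh => absurd hh hr⟩
  obtain ⟨k1, k2⟩ := key
  have hj : j = lam r - 1 := by omega
  refine ⟨r, h1, by omega, fun hr => by have := k2 hr; omega, fun n hn => hmin n (by omega), ?_⟩
  have hmono : ∀ i a d, i < l → S (i, a) ≤ S (i, a + d) := by
    intro i a d hi
    induction d with
    | zero => simp
    | succ d ih => exact ih.trans (hrow i (a + d) hi).le
  intro t
  induction t with
  | zero =>
    have : r + lam r - 1 + 0 = N := by omega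
    rw [this, hs, hj]; rfl
  | succ t ih =>
    rw [← add_assoc, slide_succ_s17 l V _ _ _ ih h1, if_neg]
    · rfl
    · rintro ⟨hr, hlt⟩
      have k3 := k2 hr
      have e1 : V (r, lam r - 1 + t + 1) = S (r, t) + c := by
        rw [← h.big r t h1]; congr 2; omega
      have e2 : V (r + 1, lam r - 1 + t) = S (r + 1, t + (lam r - 1 - lam (r + 1))) + c := by
        rw [← h.big (r + 1) _ hr]; congr 2; omega
      have := hmono (r + 1) t (lam r - 1 - lam (r + 1)) hr
      have := hcol r t hr
      omega

theorem JInv.step {l : ℕ} (hl : 1 ≤ l) {S : ℕ × ℕ → ℕ} {c : ℕ} {lam : ℕ → ℕ} {V : ℕ × ℕ → ℕ}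
    (h : JInv l S (c + 1) lam V) (hS : ∀ i j, i < l → 0 < S (i, j))
    (hrow : ∀ i j, i < l → S (i, j) < S (i, j + 1))
    (hcol : ∀ i j, i + 1 < l → S (i, j) < S (i + 1, j)) :
    ∃ lam', JInv l S c lam' (jdt (Box (l : ℕ∞)) V) := by
  obtain ⟨r, hr, hpos, hcor, hsm, hp⟩ := h.path hl hS (by omega) hrow hcol
  have hne : ∀ b : ℕ × ℕ, slide (Box (l : ℕ∞)) V (b.1 + b.2 + 1) ≠ b := by
    intro b hb
    have := (slide_diag l hl V (b.1 + b.2 + 1)).2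
    rw [hb] at this
    omega
  have hj : ∀ b : ℕ × ℕ, jdt (Box (l : ℕ∞)) V b =
      if slide (Box (l : ℕ∞)) V (b.1 + b.2) = b then
        V (slide (Box (l : ℕ∞)) V (b.1 + b.2 + 1)) - 1 else V b - 1 := by
    intro b
    rw [jdt, if_neg (hne b)]
  refine ⟨Function.update lam r (lam r - 1), ?_, ?_, ?_, ?_, ?_⟩
  · intro i hi
    have := h.anti i hi
    simp only [Function.update_apply]
    split_ifs with a b b
    · omega
    · subst a; omega
    · subst b; have := hcor hi; omega
    · exact this
  · have e := h.sum
    have hm : r ∈ Finset.range l := by simpa using hr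
    rw [Finset.sum_update_of_mem hm]
    rw [← Finset.add_sum_erase _ _ hm, ← Finset.sdiff_singleton_eq_erase] at e
    omega
  · intro i j hi
    rw [hj, if_neg]
    · rw [h.out i j hi]
    · intro hb
      have := (slide_diag l hl V (i + j)).1
      simp only at hb
      rw [hb] at this
      simp at this
      omega
  · intro i j hi hjl
    have hjl' : j < lam i := by
      simp only [Function.update_apply] at hjl
      split_ifs at hjl with a
      · subst a; omega
      · exact hjl
    rw [hj]
    split_ifs with hb
    · simp only at hb ⊢
      have hd := slide_diag l hl V (i + j + 1)
      have : (slide (Box (l : ℕ∞)) V (i + j + 1)).2 < lam (slide (Box (l : ℕ∞)) V (i + j + 1)).1 := by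
        apply hsm
        by_contra hcon
        have e := hp (i + j - (r + lam r - 1))
        rw [show r + lam r - 1 + (i + j - (r + lam r - 1)) = i + j by omega, hb] at e
        simp only [Prod.mk.injEq] at e
        obtain ⟨rfl, e⟩ := e
        simp at hjl
        omega
      have := h.small _ _ hd.1 this
      simp only [Prod.mk.eta] at this
      omega
    · have := h.small i j hi hjl'
      omega
  · intro i j hi
    rw [hj]
    by_cases hir : i = r
    · subst hir
      simp only [Function.update_self]
      have e1 := hp j
      have e2 := hp (j + 1)
      have s1 : i + (lam i - 1 + j) = i + lam i - 1 + j := by omega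
      have s2 : i + (lam i - 1 + j) + 1 = i + lam i - 1 + (j + 1) := by omega
      rw [s2, s1, e1, if_pos rfl, e2, show lam i - 1 + (j + 1) = lam i + j by omega, h.big i j hi]
      omega
    · rw [Function.update_of_ne hir, if_neg]
      · rw [h.big i j hi]; omega
      · intro hb
        simp only at hb
        by_cases hcon : i + (lam i + j) < r + lam r
        · have := hsm _ hcon
          rw [hb] at this
          simp at this
        · have e := hp (i + (lam i + j) - (r + lam r - 1))
          rw [show r + lam r - 1 + (i + (lam i + j) - (r + lam r - 1)) = i + (lam i + j) by omega,
            hb] at e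
          simp only [Prod.mk.injEq] at e
          exact hir e.1

theorem JInv.iter {l : ℕ} (hl : 1 ≤ l) {S : ℕ × ℕ → ℕ} (hS : ∀ i j, i < l → 0 < S (i, j))
    (hout : ∀ i j, l ≤ i → S (i, j) = 0)
    (hrow : ∀ i j, i < l → S (i, j) < S (i, j + 1))
    (hcol : ∀ i j, i + 1 < l → S (i, j) < S (i + 1, j)) (c : ℕ) :
    ∀ (lam : ℕ → ℕ) (V : ℕ × ℕ → ℕ), JInv l S c lam V → (jdt (Box (l : ℕ∞)))^[c] V = S := by
  induction c with
  | zero =>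
    intro lam V h
    have hz : ∀ i < l, lam i = 0 := by
      intro i hi
      exact Finset.sum_eq_zero_iff.1 h.sum i (by simpa using hi)
    funext ⟨i, j⟩
    simp only [Function.iterate_zero, id]
    by_cases hi : i < l
    · have := h.big i j hi
      rw [hz i hi] at this
      simpa using this
    · rw [h.out i j (by omega), hout i j (by omega)]
  | succ c ih =>
    intro lam V h
    obtain ⟨lam', h'⟩ := h.step hl hS hrow hcol
    rw [Function.iterate_succ_apply]
    exact ih lam' _ h'

/-- rank within the rectangle -/
noncomputable def rk (l m : ℕ) (T : ℕ × ℕ → ℕ) (b : ℕ × ℕ) : ℕ :=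
  ((Finset.range l ×ˢ Finset.range m).filter (fun c => T c ≤ T b)).card

noncomputable def perU (l m : ℕ) (T : ℕ × ℕ → ℕ) (b : ℕ × ℕ) : ℕ :=
  if b.1 < l then rk l m T (b.1, b.2 % m) + (b.2 / m) * (l * m) else 0

theorem rk_lt (l m : ℕ) (T : ℕ × ℕ → ℕ) (b c : ℕ × ℕ) (hc : c.1 < l) (hc2 : c.2 < m)
    (h : T b < T c) : rk l m T b < rk l m T c := by
  apply Finset.card_lt_card
  rw [Finset.ssubset_iff_of_subset]
  · exact ⟨c, by simp [hc, hc2], by simp [h]⟩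
  · intro x hx
    simp only [Finset.mem_filter] at *
    exact ⟨hx.1, by omega⟩

theorem rk_pos (l m : ℕ) (T : ℕ × ℕ → ℕ) (b : ℕ × ℕ) (hc : b.1 < l) (hc2 : b.2 < m) :
    0 < rk l m T b := by
  apply Finset.card_pos.2
  exact ⟨b, by simp [hc, hc2]⟩

theorem rk_le (l m : ℕ) (T : ℕ × ℕ → ℕ) (b : ℕ × ℕ) : rk l m T b ≤ l * m := by
  refine (Finset.card_filter_le _ _).trans ?_
  simp

theorem rk_inj (l m : ℕ) (T : ℕ × ℕ → ℕ) (hT : IsSYT (l : ℕ∞) T) (b c : ℕ × ℕ) (hb : b.1 < l)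
    (hb2 : b.2 < m) (hc : c.1 < l) (hc2 : c.2 < m) (h : rk l m T b = rk l m T c) : b = c := by
  apply hT.inj b c ((box_iff _ _).2 hb) ((box_iff _ _).2 hc)
  rcases lt_trichotomy (T b) (T c) with h1 | h1 | h1
  · have := rk_lt l m T b c hc hc2 h1; omega
  · exact h1
  · have := rk_lt l m T c b hb hb2 h1; omega

theorem rk_surj (l m : ℕ) (T : ℕ × ℕ → ℕ) (hT : IsSYT (l : ℕ∞) T) (n : ℕ) (hn : 0 < n)
    (hn2 : n ≤ l * m) : ∃ b : ℕ × ℕ, b.1 < l ∧ b.2 < m ∧ rk l m T b = n := by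
  have hi : (Finset.range l ×ˢ Finset.range m).image (rk l m T) = Finset.Icc 1 (l * m) := by
    apply Finset.eq_of_subset_of_card_le
    · intro x hx
      obtain ⟨b, hb, rfl⟩ := Finset.mem_image.1 hx
      simp only [Finset.mem_product, Finset.mem_range] at hb
      exact Finset.mem_Icc.2 ⟨rk_pos l m T b hb.1 hb.2, rk_le l m T b⟩
    · rw [Finset.card_image_of_injOn]
      · simp
      · intro b hb c hc h
        simp at hb hc
        exact rk_inj l m T hT b c hb.1 hb.2 hc.1 hc.2 h
  have : n ∈ (Finset.range l ×ˢ Finset.range m).image (rk l m T) := by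
    rw [hi]; exact Finset.mem_Icc.2 ⟨hn, hn2⟩
  obtain ⟨b, hb, rfl⟩ := Finset.mem_image.1 this
  simp only [Finset.mem_product, Finset.mem_range] at hb
  exact ⟨b, hb.1, hb.2, rfl⟩

theorem col_bound (l : ℕ) (T : ℕ × ℕ → ℕ) (hT : IsSYT (l : ℕ∞) T) (i j : ℕ) (hi : i < l) :
    j < T (i, j) := by
  induction j with
  | zero => exact hT.pos _ ((box_iff _ _).2 hi)
  | succ j ih =>
    have := hT.row_lt (i, j) ((box_iff _ _).2 hi)
    simp only at this
    omega

theorem rk_eq (l m : ℕ) (T : ℕ × ℕ → ℕ) (hT : IsSYT (l : ℕ∞) T) (b : ℕ × ℕ)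
    (hm : T b ≤ m) : rk l m T b = T b := by
  have hi : ((Finset.range l ×ˢ Finset.range m).filter (fun c => T c ≤ T b)).image T
      = Finset.Icc 1 (T b) := by
    ext n
    simp only [Finset.mem_image, Finset.mem_filter, Finset.mem_product, Finset.mem_range,
      Finset.mem_Icc]
    constructor
    · rintro ⟨c, ⟨⟨h1, h2⟩, h3⟩, rfl⟩
      exact ⟨hT.pos _ ((box_iff _ _).2 h1), h3⟩
    · rintro ⟨h1, h2⟩
      obtain ⟨c, hc, rfl⟩ := hT.surj n h1
      rw [box_iff] at hc
      have := col_bound l T hT c.1 c.2 hc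
      simp only [Prod.mk.eta] at this
      exact ⟨c, ⟨⟨hc, by omega⟩, h2⟩, rfl⟩
  have := congrArg Finset.card hi
  rw [Finset.card_image_of_injOn] at this
  · simpa [rk] using this
  · intro x hx y hy h
    simp at hx hy
    exact hT.inj x y ((box_iff _ _).2 hx.1.1) ((box_iff _ _).2 hy.1.1) h

theorem perU_isSYT (l m : ℕ) (hl : 1 ≤ l) (hm : 0 < m) (T : ℕ × ℕ → ℕ) (hT : IsSYT (l : ℕ∞) T) :
    IsSYT (l : ℕ∞) (perU l m T) := by
  have hlm : 0 < l * m := Nat.mul_pos (by omega) hm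
  constructor
  · intro b hb
    rw [box_iff] at hb
    simp [perU, hb]
  · intro b hb
    rw [box_iff] at hb
    have := rk_pos l m T (b.1, b.2 % m) hb (Nat.mod_lt _ hm)
    simp only [perU, hb, if_true]
    omega
  · intro b c hb hc h
    rw [box_iff] at hb hc
    simp only [perU, hb, hc, if_true] at h
    have p1 := rk_pos l m T (b.1, b.2 % m) hb (Nat.mod_lt _ hm)
    have p2 := rk_pos l m T (c.1, c.2 % m) hc (Nat.mod_lt _ hm)
    have q1 := rk_le l m T (b.1, b.2 % m)
    have q2 := rk_le l m T (c.1, c.2 % m)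
    have hq : b.2 / m = c.2 / m := by
      rcases lt_trichotomy (b.2 / m) (c.2 / m) with h1 | h1 | h1
      · have := Nat.mul_le_mul_right (l * m) (Nat.succ_le_of_lt h1)
        rw [Nat.succ_mul] at this
        omega
      · exact h1
      · have := Nat.mul_le_mul_right (l * m) (Nat.succ_le_of_lt h1)
        rw [Nat.succ_mul] at this
        omega
    rw [hq] at h
    have := rk_inj l m T hT (b.1, b.2 % m) (c.1, c.2 % m) hb (Nat.mod_lt _ hm) hc (Nat.mod_lt _ hm) (Nat.add_right_cancel h)
    simp only [Prod.mk.injEq] at this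
    refine Prod.ext this.1 ?_
    rw [← Nat.mod_add_div b.2 m, ← Nat.mod_add_div c.2 m, hq, this.2]
  · intro n hn
    obtain ⟨b, h1, h2, h3⟩ := rk_surj l m T hT ((n - 1) % (l * m) + 1) (by omega)
      (Nat.mod_lt _ hlm)
    refine ⟨(b.1, b.2 + m * ((n - 1) / (l * m))), (box_iff _ _).2 h1, ?_⟩
    simp only [perU, h1, if_true]
    rw [Nat.add_mul_mod_self_left, Nat.mod_eq_of_lt h2, Nat.add_mul_div_left _ _ hm,
      Nat.div_eq_of_lt h2, zero_add, Prod.mk.eta, h3]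
    have := Nat.mod_add_div (n - 1) (l * m)
    rw [mul_comm (l * m) ((n - 1) / (l * m))] at this
    omega
  · rintro ⟨i, j⟩ hb
    rw [box_iff] at hb
    simp only at hb
    have hj := Nat.mod_add_div j m
    have hlt := Nat.mod_lt j hm
    simp only [perU, hb, if_true]
    generalize j / m = q at *
    generalize j % m = r at *
    subst hj
    by_cases hr : r + 1 < m
    · rw [show r + m * q + 1 = (r + 1) + m * q by ring, Nat.add_mul_mod_self_left,
        Nat.mod_eq_of_lt hr, Nat.add_mul_div_left _ _ hm, Nat.div_eq_of_lt hr, zero_add]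
      have := rk_lt l m T (i, r) (i, r + 1) hb hr (hT.row_lt (i, r) ((box_iff _ _).2 hb))
      omega
    · have hr' : r + 1 = m := by omega
      rw [show r + m * q + 1 = 0 + m * (q + 1) by rw [← hr']; ring, Nat.add_mul_mod_self_left,
        Nat.mod_eq_of_lt hm, Nat.add_mul_div_left _ _ hm, Nat.div_eq_of_lt hm, zero_add]
      have := rk_le l m T (i, r)
      have := rk_pos l m T (i, 0) hb hm
      rw [Nat.succ_mul]
      omega
  · rintro ⟨i, j⟩ hb
    have hb' := hb
    rw [box_iff] at hb
    simp only at hb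
    have hi : i < l := by omega
    simp only [perU, hb, hi, if_true]
    have := rk_lt l m T (i, j % m) (i + 1, j % m) hb (Nat.mod_lt _ hm)
      (hT.col_lt (i, j % m) ((box_iff _ _).2 hb))
    omega

theorem perU_periodic (l m : ℕ) (hl : 1 ≤ l) (hm : 0 < m) (T : ℕ × ℕ → ℕ)
    (hT : IsSYT (l : ℕ∞) T) :
    (jdt (Box (l : ℕ∞)))^[l * m] (perU l m T) = perU l m T := by
  have hU := perU_isSYT l m hl hm T hT
  have hout : ∀ i j, l ≤ i → perU l m T (i, j) = 0 := by
    intro i j hi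
    simp [perU, hi]
  refine JInv.iter hl (fun i j hi => hU.pos _ ((box_iff _ _).2 hi)) hout
    (fun i j hi => hU.row_lt (i, j) ((box_iff _ _).2 hi))
    (fun i j hi => hU.col_lt (i, j) ((box_iff _ _).2 hi)) _ (fun _ => m) _
    ⟨fun _ _ => le_rfl, by simp, hout, ?_, ?_⟩
  · intro i j hi hj
    simp only [perU, hi, if_true, Nat.div_eq_of_lt hj, zero_mul, add_zero]
    exact rk_le _ _ _ _
  · intro i j hi
    simp only [perU, hi, if_true]
    rw [Nat.add_mod_left, Nat.add_div_left _ hm, Nat.succ_mul]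
    omega

theorem summ : Summable (fun b : ℕ × ℕ => ((2 : ℝ) ^ (b.1 + b.2 + 2))⁻¹) := by
  have h : Summable (fun n : ℕ => ((1 : ℝ) / 2) ^ n) := summable_geometric_two
  have h2 := (h.mul_of_nonneg h (fun _ => by positivity) (fun _ => by positivity)).mul_left (1 / 4)
  refine h2.congr ?_
  intro b
  simp only [pow_add, one_div, inv_pow, mul_inv]
  ring

theorem stmt_17 (l : ℕ) (hl : 1 ≤ l) (T : ℕ × ℕ → ℕ) (hT : IsSYT (l : ℕ∞) T)
    (ε : ℝ) (hε : 0 < ε) :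
    ∃ U : ℕ × ℕ → ℕ, IsSYT (l : ℕ∞) U ∧
      (∃ k : ℕ, 1 ≤ k ∧ (jdt (Box (l : ℕ∞)))^[k] U = U) ∧ dSYT T U < ε := by
  set f : ℕ × ℕ → ℝ := fun b => ((2 : ℝ) ^ (b.1 + b.2 + 2))⁻¹ with hf
  have hfn : ∀ b, 0 ≤ f b := fun b => by positivity
  have ht := tendsto_tsum_compl_atTop_zero f
  obtain ⟨s, hs⟩ := (ht.eventually (gt_mem_nhds hε)).exists
  have hm : 0 < s.sup T + 1 := by omega
  refine ⟨perU l (s.sup T + 1) T, perU_isSYT l _ hl hm T hT,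
    ⟨l * (s.sup T + 1), Nat.mul_pos (by omega) hm, perU_periodic l _ hl hm T hT⟩, ?_⟩
  refine lt_of_le_of_lt ?_ hs
  have hag : ∀ b ∈ s, T b = perU l (s.sup T + 1) T b := by
    intro b hb
    have hle : T b ≤ s.sup T := Finset.le_sup hb
    by_cases hi : b.1 < l
    · have := col_bound l T hT b.1 b.2 hi
      simp only [Prod.mk.eta] at this
      have hlt : b.2 < s.sup T + 1 := by omega
      simp only [perU, hi, if_true, Nat.mod_eq_of_lt hlt, Nat.div_eq_of_lt hlt]
      rw [Prod.mk.eta, rk_eq l _ T hT b (by omega)]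
      simp
    · rw [hT.zero_outside b (by rwa [box_iff])]
      simp [perU, hi]
  have e : (∑' a : {x // x ∉ s}, f a) = ∑' b, ({x | x ∉ s} : Set (ℕ × ℕ)).indicator f b :=
    tsum_subtype ({x | x ∉ s} : Set (ℕ × ℕ)) f
  rw [e, dSYT]
  have hle : ∀ b, (if T b ≠ perU l (s.sup T + 1) T b then ((2 : ℝ) ^ (b.1 + b.2 + 2))⁻¹ else 0)
      ≤ ({x | x ∉ s} : Set (ℕ × ℕ)).indicator f b := by
    intro b
    by_cases hb : b ∈ s
    · rw [if_neg (by simpa using hag b hb)]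
      exact Set.indicator_nonneg (fun _ _ => hfn _) _
    · rw [Set.indicator_of_mem (by simpa using hb)]
      split_ifs
      · exact le_rfl
      · exact hfn b
  have hsi := summ.indicator ({x | x ∉ s} : Set (ℕ × ℕ))
  refine Summable.tsum_le_tsum hle (Summable.of_nonneg_of_le ?_ hle hsi) hsi
  intro b
  split_ifs
  · exact hfn b
  · exact le_rfl
end
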